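/- arXiv:2303.06613 — 3 statements merged into one kernel-verified Lean document; each statement's English description precedes it below -/
import Mathlib

section
/- For every real number a > 0 and every real number ℓ ≥ 2, one has ∫₀¹ [sin(πav)/(πv)]·(1 − v)^{ℓ²} dv ≥ (1/π)·arctan(πa/ℓ²) − 2e^{−ℓ}/(πℓ) − 2a/ℓ⁴. -/
open Real

theorem integrableOn_exp_mul_cos_Ioi {N : ℝ} (hN : 0 < N) (b : ℝ) :
    MeasureTheory.IntegrableOn (fun v : ℝ ↦ exp (-N * v) * cos (b * v)) (Set.Ioi 0) := by
  refine MeasureTheory.Integrable.mono (integrableOn_exp_mul_Ioi (neg_neg_of_pos hN) 0)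
    (by fun_prop) (.of_forall fun v ↦ ?_)
  rw [norm_mul]
  exact mul_le_of_le_one_right (norm_nonneg _) (abs_cos_le_one _)

theorem integral_exp_mul_cos_Ioi {N : ℝ} (hN : 0 < N) (b : ℝ) :
    ∫ v in Set.Ioi (0 : ℝ), exp (-N * v) * cos (b * v) = N / (N ^ 2 + b ^ 2) := by
  have hre : (-N + b * Complex.I : ℂ).re < 0 := by simpa using hN
  have hexp (v : ℝ) : exp (-N * v) * cos (b * v) =
      RCLike.re (Complex.exp ((-N + b * Complex.I) * v)) := by
    simp [Complex.exp_re]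
  simp_rw [hexp]
  rw [integral_re (integrableOn_exp_mul_complex_Ioi hre 0), integral_exp_mul_complex_Ioi hre]
  simp [Complex.div_re, Complex.normSq_apply, sq]

theorem integral_one_sub_rpow {N : ℝ} (hN : 0 < N) :
    ∫ v in (0 : ℝ)..1, (1 - v) ^ N = 1 / (N + 1) := by
  rw [intervalIntegral.integral_comp_sub_left (fun x : ℝ ↦ x ^ N),
    integral_rpow (Or.inl (by linarith))]
  simp [zero_rpow (by linarith : N + 1 ≠ 0)]

theorem continuous_one_sub_rpow {N : ℝ} (hN : 0 < N) : Continuous fun v : ℝ ↦ (1 - v) ^ N :=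
  (continuous_const.sub continuous_id).rpow_const fun _ ↦ Or.inr hN.le

theorem one_sub_rpow_le_exp {N v : ℝ} (hN : 0 ≤ N) (hv : v ≤ 1) :
    (1 - v) ^ N ≤ exp (-N * v) := by
  calc (1 - v) ^ N ≤ exp (-v) ^ N :=
        rpow_le_rpow (by linarith) (one_sub_le_exp_neg v) hN
    _ = exp (-N * v) := by rw [← exp_mul]; ring_nf

theorem integral_cos_mul_one_sub_rpow_lower_bound {N : ℝ} (hN : 0 < N) (b : ℝ) :
    N / (N ^ 2 + b ^ 2) - 1 / N ^ 2 ≤ ∫ v in (0 : ℝ)..1, cos (b * v) * (1 - v) ^ N := by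
  have hcont := continuous_one_sub_rpow hN
  have hint : MeasureTheory.IntegrableOn
      (fun v : ℝ ↦ exp (-N * v) - exp (-N * v) * cos (b * v)) (Set.Ioi 0) :=
    (integrableOn_exp_mul_Ioi (neg_neg_of_pos hN) 0).sub (integrableOn_exp_mul_cos_Ioi hN b)
  have hval : ∫ v in Set.Ioi (0 : ℝ), (exp (-N * v) - exp (-N * v) * cos (b * v)) =
      1 / N - N / (N ^ 2 + b ^ 2) := by
    rw [MeasureTheory.integral_sub (integrableOn_exp_mul_Ioi (neg_neg_of_pos hN) 0)
      (integrableOn_exp_mul_cos_Ioi hN b), integral_exp_mul_cos_Ioi hN,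
      integral_exp_mul_Ioi (neg_neg_of_pos hN)]
    simp
  have hle : ∫ v in (0 : ℝ)..1, ((1 - v) ^ N - cos (b * v) * (1 - v) ^ N) ≤
      ∫ v in Set.Ioi (0 : ℝ), (exp (-N * v) - exp (-N * v) * cos (b * v)) := by
    calc _ ≤ ∫ v in (0 : ℝ)..1, (exp (-N * v) - exp (-N * v) * cos (b * v)) := by
          refine intervalIntegral.integral_mono_on zero_le_one
            (Continuous.intervalIntegrable (by fun_prop) _ _)
            (Continuous.intervalIntegrable (by fun_prop) _ _) fun v hv ↦ ?_
          nlinarith [one_sub_rpow_le_exp hN.le hv.2, cos_le_one (b * v)]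
      _ ≤ _ := by
          rw [intervalIntegral.integral_of_le zero_le_one]
          refine MeasureTheory.setIntegral_mono_set hint (.of_forall fun v ↦ ?_)
            (Set.Ioc_subset_Ioi_self.eventuallyLE)
          show 0 ≤ exp (-N * v) - exp (-N * v) * cos (b * v)
          nlinarith [exp_pos (-N * v), cos_le_one (b * v)]
  rw [hval, intervalIntegral.integral_sub (hcont.intervalIntegrable _ _)
    (Continuous.intervalIntegrable (by fun_prop) _ _), integral_one_sub_rpow hN] at hle
  have hdiff : 1 / N - 1 / (N + 1) ≤ 1 / N ^ 2 := by
    rw [div_sub_div _ _ hN.ne' (by positivity), div_le_div_iff₀ (by positivity) (by positivity)]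
    nlinarith
  linarith

theorem integral_cos_pi_mul (a : ℝ) {v : ℝ} (hv : v ≠ 0) :
    ∫ t in (0 : ℝ)..a, cos (π * t * v) = sin (π * a * v) / (π * v) := by
  have h (t : ℝ) : π * t * v = (π * v) * t := by ring
  simp_rw [h]
  rw [intervalIntegral.integral_comp_mul_left _ (mul_ne_zero pi_ne_zero hv), integral_cos]
  simp [div_eq_inv_mul]

theorem continuous_cos_mul_one_sub_rpow {N : ℝ} (hN : 0 < N) :
    Continuous (Function.uncurry fun t v : ℝ ↦ cos (π * t * v) * (1 - v) ^ N) :=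
  (by fun_prop : Continuous fun p : ℝ × ℝ ↦ cos (π * p.1 * p.2)).mul
    ((continuous_one_sub_rpow hN).comp continuous_snd)

theorem integral_sin_div_mul_one_sub_rpow {N : ℝ} (hN : 0 < N) (a : ℝ) :
    ∫ v in (0 : ℝ)..1, sin (π * a * v) / (π * v) * (1 - v) ^ N =
      ∫ t in (0 : ℝ)..a, ∫ v in (0 : ℝ)..1, cos (π * t * v) * (1 - v) ^ N := by
  have hcont := continuous_cos_mul_one_sub_rpow hN
  rw [MeasureTheory.intervalIntegral_intervalIntegral_swap]
  · refine intervalIntegral.integral_congr_ae (.of_forall fun v hv ↦ ?_)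
    rw [Set.uIoc_of_le zero_le_one] at hv
    rw [intervalIntegral.integral_mul_const, integral_cos_pi_mul a hv.1.ne']
  · exact (hcont.continuousOn.integrableOn_compact
      (isCompact_uIcc.prod isCompact_uIcc)).mono_set
      (Set.prod_mono Set.uIoc_subset_uIcc Set.uIoc_subset_uIcc)

theorem integral_div_sq_add_pi_mul_sq {N : ℝ} (hN : 0 < N) (a : ℝ) :
    ∫ t in (0 : ℝ)..a, N / (N ^ 2 + (π * t) ^ 2) = 1 / π * arctan (π * a / N) := by
  have hπ := pi_pos
  have h (t : ℝ) : N / (N ^ 2 + (π * t) ^ 2) = N⁻¹ * (1 + (π / N * t) ^ 2)⁻¹ := by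
    field_simp
  simp_rw [h]
  rw [intervalIntegral.integral_const_mul,
    intervalIntegral.integral_comp_mul_left (fun x ↦ (1 + x ^ 2)⁻¹) (by positivity),
    integral_inv_one_add_sq]
  simp only [mul_zero, arctan_zero, sub_zero, smul_eq_mul]
  rw [div_mul_eq_mul_div]
  field_simp

/-- For every `a > 0` and every `ℓ ≥ 2`,
`∫₀¹ (sin(πav)/(πv)) (1-v)^{ℓ²} dv ≥ (1/π) arctan(πa/ℓ²) - 2e^{-ℓ}/(πℓ) - 2a/ℓ⁴`. -/
theorem integral_sin_one_sub_pow_lower_bound (a : ℝ) (ha : 0 < a) (ℓ : ℝ) (hℓ : 2 ≤ ℓ) :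
    (1 / Real.pi) * Real.arctan (Real.pi * a / ℓ ^ 2) - 2 * Real.exp (-ℓ) / (Real.pi * ℓ)
        - 2 * a / ℓ ^ 4 ≤
      ∫ v in (0 : ℝ)..1,
        Real.sin (Real.pi * a * v) / (Real.pi * v) * (1 - v) ^ (ℓ ^ 2) := by
  have hN : 0 < ℓ ^ 2 := by positivity
  have hcont : Continuous fun t : ℝ ↦
      ∫ v in (0 : ℝ)..1, cos (π * t * v) * (1 - v) ^ (ℓ ^ 2) :=
    intervalIntegral.continuous_parametric_intervalIntegral_of_continuous'
      (continuous_cos_mul_one_sub_rpow hN) 0 1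
  have hden : Continuous fun t : ℝ ↦ ℓ ^ 2 / ((ℓ ^ 2) ^ 2 + (π * t) ^ 2) :=
    continuous_const.div (by fun_prop) fun t ↦ by positivity
  have hle := intervalIntegral.integral_mono_on (μ := MeasureTheory.volume) ha.le
    ((hden.sub continuous_const).intervalIntegrable _ _) (hcont.intervalIntegrable _ _)
    fun t _ ↦ integral_cos_mul_one_sub_rpow_lower_bound hN (π * t)
  simp only [Pi.sub_apply] at hle
  rw [← integral_sin_div_mul_one_sub_rpow hN, intervalIntegral.integral_sub
    (hden.intervalIntegrable _ _) (continuous_const.intervalIntegrable _ _),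
    integral_div_sq_add_pi_mul_sq hN, intervalIntegral.integral_const, smul_eq_mul] at hle
  have hexp : 0 ≤ 2 * exp (-ℓ) / (π * ℓ) := by positivity
  have herr : (a - 0) * (1 / (ℓ ^ 2) ^ 2) ≤ 2 * a / ℓ ^ 4 := by
    rw [← pow_mul, sub_zero, mul_one_div]
    gcongr
    linarith
  linarith
end

section
/- With ϑ = 0.61861, for every real number r ≥ 8 one has A₀ − { (1 − √(1 − ϑ/√r))·A₀ + (4/√r)·( e^{−B₀√(r − ϑ√r)}/π + 1/(B₀³·√(r − ϑ√r)) ) } ≥ 0.62 > ϑ; moreover the expression in braces is monotonically decreasing as a function of r for r ≥ 1. -/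
open Real

theorem sub_cube_div_three_le_arctan {x : ℝ} (hx : 0 ≤ x) : x - x ^ 3 / 3 ≤ Real.arctan x := by
  have hd : ∀ y : ℝ, HasDerivAt (fun y : ℝ => Real.arctan y - (y - y ^ 3 / 3))
      (1 / (1 + y ^ 2) - (1 - y ^ 2)) y := fun y => by
    have h := (Real.hasDerivAt_arctan y).sub
      ((hasDerivAt_id y).sub (((hasDerivAt_id y).pow 3).div_const 3))
    refine h.congr_deriv ?_
    simp
  have hm : Monotone (fun y : ℝ => Real.arctan y - (y - y ^ 3 / 3)) := by
    refine monotone_of_deriv_nonneg (fun y => (hd y).differentiableAt) fun y => ?_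
    rw [(hd y).deriv, sub_nonneg, le_div_iff₀ (by positivity)]
    nlinarith [sq_nonneg (y ^ 2)]
  have h := hm hx
  simp only [Real.arctan_zero] at h
  linarith

theorem arctan_eq_pi_div_four_add {u : ℝ} (hu : 0 < u) :
    Real.arctan u = Real.pi / 4 + Real.arctan ((u - 1) / (u + 1)) := by
  have h : 1 * ((u - 1) / (u + 1)) < 1 := by
    rw [one_mul, div_lt_one (by linarith)]
    linarith
  rw [← Real.arctan_one, Real.arctan_add h]
  congr 1
  field_simp
  ring

theorem two_mul_div_one_add_sq_lt_arctan {u : ℝ} (hu : 1.405 ≤ u) :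
    2 * u / (1 + u ^ 2) < Real.arctan u := by
  have hd : ∀ y : ℝ, HasDerivAt (fun y : ℝ => Real.arctan y - 2 * y / (1 + y ^ 2))
      ((3 * y ^ 2 - 1) / (1 + y ^ 2) ^ 2) y := fun y => by
    have hy : 1 + y ^ 2 ≠ 0 := by positivity
    have h := (Real.hasDerivAt_arctan y).sub
      (((hasDerivAt_id y).const_mul 2).div (((hasDerivAt_id y).pow 2).const_add 1) hy)
    refine h.congr_deriv ?_
    simp
    field_simp
    ring
  have hm : MonotoneOn (fun y : ℝ => Real.arctan y - 2 * y / (1 + y ^ 2)) (Set.Ici 1.405) := by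
    refine monotoneOn_of_deriv_nonneg (convex_Ici _)
      (fun y _ => (hd y).continuousAt.continuousWithinAt)
      (fun y _ => (hd y).differentiableAt.differentiableWithinAt) fun y hy => ?_
    rw [interior_Ici, Set.mem_Ioi] at hy
    rw [(hd y).deriv]
    apply div_nonneg _ (by positivity)
    nlinarith
  have h := hm Set.self_mem_Ici hu hu
  have h1 := sub_cube_div_three_le_arctan (x := (1.405 - 1) / (1.405 + 1)) (by norm_num)
  have h2 := arctan_eq_pi_div_four_add (u := 1.405) (by norm_num)
  have h3 := Real.pi_gt_d4
  have h4 : (0 : ℝ) < Real.arctan 1.405 - 2 * 1.405 / (1 + 1.405 ^ 2) := by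
    norm_num at h1 h2 h3 ⊢
    linarith
  simp only at h
  linarith

theorem arctan_eq_of_forall_le {B₀ : ℝ} (hB₀pos : 0 < B₀)
    (hB₀max : ∀ B : ℝ, 0 < B →
      B * Real.arctan (Real.pi / B ^ 2) ≤ B₀ * Real.arctan (Real.pi / B₀ ^ 2)) :
    Real.arctan (Real.pi / B₀ ^ 2) =
      2 * (Real.pi / B₀ ^ 2) / (1 + (Real.pi / B₀ ^ 2) ^ 2) := by
  have hmax : IsLocalMax (fun B : ℝ => B * Real.arctan (Real.pi / B ^ 2)) B₀ := by
    filter_upwards [lt_mem_nhds hB₀pos] with B hB using hB₀max B hB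
  have hne : B₀ ^ 2 ≠ 0 := by positivity
  have hd := (hasDerivAt_id B₀).mul
    (((hasDerivAt_const B₀ Real.pi).div ((hasDerivAt_id B₀).pow 2) hne).arctan)
  have h := hmax.hasDerivAt_eq_zero hd
  simp at h
  rw [← sub_eq_zero, ← h]
  have : B₀ ^ 4 + Real.pi ^ 2 ≠ 0 := by positivity
  field_simp
  ring

theorem lower_bound_of_forall_le {B₀ : ℝ} (hB₀pos : 0 < B₀)
    (hB₀max : ∀ B : ℝ, 0 < B →
      B * Real.arctan (Real.pi / B ^ 2) ≤ B₀ * Real.arctan (Real.pi / B₀ ^ 2)) :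
    1.495 ≤ B₀ := by
  by_contra! hlt
  have hu : 1.405 ≤ Real.pi / B₀ ^ 2 := by
    rw [le_div_iff₀ (by positivity)]
    nlinarith [Real.pi_gt_d4]
  have h := two_mul_div_one_add_sq_lt_arctan hu
  rw [arctan_eq_of_forall_le hB₀pos hB₀max] at h
  exact lt_irrefl _ h

theorem lower_bound_max_value :
    0.906 ≤ 2 * 1.5 / Real.pi * Real.arctan (Real.pi / 1.5 ^ 2) := by
  have h3 := Real.pi_gt_d4
  have h4 := Real.pi_lt_d4
  have hpi := Real.pi_pos
  have hy : 0.1653 ≤ (Real.pi / 1.5 ^ 2 - 1) / (Real.pi / 1.5 ^ 2 + 1) := by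
    rw [le_div_iff₀ (by positivity)]
    norm_num at h3 ⊢
    linarith
  have h1 := sub_cube_div_three_le_arctan (x := 0.1653) (by norm_num)
  have h2 := Real.arctan_mono hy
  rw [arctan_eq_pi_div_four_add (by positivity), div_mul_eq_mul_div, le_div_iff₀ hpi]
  have h5 := h1.trans h2
  linarith

theorem antitoneOn_bracket {A B ϑ : ℝ} (hA : 0 ≤ A) (hB : 0 < B) (hϑ0 : 0 ≤ ϑ) (hϑ1 : ϑ < 1) :
    AntitoneOn (fun r : ℝ =>
      (1 - Real.sqrt (1 - ϑ / Real.sqrt r)) * A +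
        4 / Real.sqrt r * (Real.exp (-(B * Real.sqrt (r - ϑ * Real.sqrt r))) / Real.pi +
          1 / (B ^ 3 * Real.sqrt (r - ϑ * Real.sqrt r)))) (Set.Ici 1) := by
  intro r hr s _ hrs
  have hr1 : 1 ≤ Real.sqrt r := Real.one_le_sqrt.mpr hr
  have hs : Real.sqrt r ≤ Real.sqrt s := Real.sqrt_le_sqrt hrs
  have hr2 : Real.sqrt r ^ 2 = r := Real.sq_sqrt (zero_le_one.trans hr)
  have hs2 : Real.sqrt s ^ 2 = s := Real.sq_sqrt (zero_le_one.trans (le_trans hr hrs))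
  have hw : r - ϑ * Real.sqrt r ≤ s - ϑ * Real.sqrt s := by nlinarith
  have hpos : 0 < Real.sqrt (r - ϑ * Real.sqrt r) := Real.sqrt_pos.mpr (by nlinarith)
  have hpi := Real.pi_pos
  dsimp only
  gcongr

theorem exp_neg_le_of_le {x : ℝ} (hx : 3.7375 ≤ x) : Real.exp (-x) ≤ 0.025 := by
  have h1 : (2.718 : ℝ) ^ 3 ≤ Real.exp 1 ^ 3 := by
    gcongr
    linarith [Real.exp_one_gt_d9]
  have h2 := Real.quadratic_le_exp_of_nonneg (x := 0.7375) (by norm_num)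
  have h3 : Real.exp 3.7375 = Real.exp 1 ^ 3 * Real.exp 0.7375 := by
    rw [← Real.exp_nat_mul, ← Real.exp_add]
    norm_num
  have h4 : (40 : ℝ) ≤ Real.exp x := by
    refine le_trans ?_ (Real.exp_le_exp.mpr hx)
    rw [h3]
    refine le_trans ?_ (mul_le_mul h1 h2 (by norm_num) (by positivity))
    norm_num
  rw [Real.exp_neg]
  refine (inv_anti₀ (by norm_num) h4).trans (by norm_num)

theorem bracket_eight_le {A B : ℝ} (hA : 0.906 ≤ A) (hB : 1.495 ≤ B) :
    (1 - Real.sqrt (1 - 0.61861 / Real.sqrt 8)) * A +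
        4 / Real.sqrt 8 * (Real.exp (-(B * Real.sqrt (8 - 0.61861 * Real.sqrt 8))) / Real.pi +
          1 / (B ^ 3 * Real.sqrt (8 - 0.61861 * Real.sqrt 8))) ≤ A - 0.62 := by
  have hs1 : 2.8284 ≤ Real.sqrt 8 := Real.le_sqrt_of_sq_le (by norm_num)
  have hs2 : Real.sqrt 8 ≤ 2.8285 := Real.sqrt_le_iff.mpr (by norm_num)
  have hw : 2.5 ≤ Real.sqrt (8 - 0.61861 * Real.sqrt 8) := by
    apply Real.le_sqrt_of_sq_le
    norm_num at hs2 ⊢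
    linarith
  have hq : 0.8838 ≤ Real.sqrt (1 - 0.61861 / Real.sqrt 8) := by
    apply Real.le_sqrt_of_sq_le
    have : 0.61861 / Real.sqrt 8 ≤ 0.61861 / 2.8284 := by gcongr
    norm_num at this ⊢
    linarith
  have he : Real.exp (-(B * Real.sqrt (8 - 0.61861 * Real.sqrt 8))) ≤ 0.025 := by
    apply exp_neg_le_of_le
    nlinarith
  have htail : 4 / Real.sqrt 8 *
      (Real.exp (-(B * Real.sqrt (8 - 0.61861 * Real.sqrt 8))) / Real.pi +
        1 / (B ^ 3 * Real.sqrt (8 - 0.61861 * Real.sqrt 8))) ≤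
      4 / 2.8284 * (0.025 / 3.1415 + 1 / (1.495 ^ 3 * 2.5)) := by
    have hpi : 3.1415 ≤ Real.pi := Real.pi_gt_d4.le
    gcongr
  have hmain : 0.8838 * 0.906 ≤ Real.sqrt (1 - 0.61861 / Real.sqrt 8) * A :=
    mul_le_mul hq hA (by norm_num) (Real.sqrt_nonneg _)
  norm_num at htail hmain ⊢
  linarith

/-- Let `B₀` be the unique maximum point on `(0,∞)` of `B ↦ B · arctan(π/B²)` and
`A₀ = (2B₀/π) arctan(π/B₀²)`. With `ϑ = 0.61861`, for every real `r ≥ 8`,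
`A₀ - {(1 - √(1 - ϑ/√r)) A₀ + (4/√r)(e^{-B₀√(r-ϑ√r)}/π + 1/(B₀³√(r-ϑ√r)))} ≥ 0.62 > ϑ`;
moreover the expression in braces is monotonically decreasing in `r` for `r ≥ 1`. -/
theorem small_gaps_bracket_bound (B₀ A₀ : ℝ) (hB₀pos : 0 < B₀)
    (hB₀max : ∀ B : ℝ, 0 < B →
      B * Real.arctan (Real.pi / B ^ 2) ≤ B₀ * Real.arctan (Real.pi / B₀ ^ 2))
    (hB₀uniq : ∀ B : ℝ, 0 < B →
      B * Real.arctan (Real.pi / B ^ 2) = B₀ * Real.arctan (Real.pi / B₀ ^ 2) → B = B₀)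
    (hA₀ : A₀ = 2 * B₀ / Real.pi * Real.arctan (Real.pi / B₀ ^ 2))
    (ϑ : ℝ) (hϑ : ϑ = 0.61861) :
    (∀ r : ℝ, 8 ≤ r →
      0.62 ≤ A₀ - ((1 - Real.sqrt (1 - ϑ / Real.sqrt r)) * A₀ +
        4 / Real.sqrt r * (Real.exp (-(B₀ * Real.sqrt (r - ϑ * Real.sqrt r))) / Real.pi +
          1 / (B₀ ^ 3 * Real.sqrt (r - ϑ * Real.sqrt r))))) ∧
    ϑ < 0.62 ∧
    AntitoneOn (fun r : ℝ =>
      (1 - Real.sqrt (1 - ϑ / Real.sqrt r)) * A₀ +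
        4 / Real.sqrt r * (Real.exp (-(B₀ * Real.sqrt (r - ϑ * Real.sqrt r))) / Real.pi +
          1 / (B₀ ^ 3 * Real.sqrt (r - ϑ * Real.sqrt r)))) (Set.Ici 1) := by
  subst hϑ
  have hB : 1.495 ≤ B₀ := lower_bound_of_forall_le hB₀pos hB₀max
  have hA : 0.906 ≤ A₀ := by
    refine lower_bound_max_value.trans ?_
    rw [hA₀, mul_div_right_comm, mul_div_right_comm, mul_assoc, mul_assoc]
    exact mul_le_mul_of_nonneg_left (hB₀max 1.5 (by norm_num)) (by positivity)
  have hanti := antitoneOn_bracket (A := A₀) (B := B₀) (ϑ := 0.61861) (by linarith) hB₀pos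
    (by norm_num) (by norm_num)
  refine ⟨fun r hr => ?_, by norm_num, hanti⟩
  have h8 := hanti (a := 8) (b := r) (by norm_num) (by simp; linarith) hr
  have hbr := bracket_eight_le hA hB
  simp only at h8
  linarith
end

section
/- The function B ↦ (2B/π)·arctan(π/B²) on (0,∞) attains a maximum value A₀ at a unique point B₀, and these satisfy 1.502432 < B₀ < 1.502433 and 0.9064997 < A₀ < 0.9064998. -/
open Real

/-- The error of the `n`-th Taylor polynomial of `arctan` has the sign `(-1) ^ n` on `[0, ∞)`. -/
lemma arctan_taylor_error_nonneg (n : ℕ) {x : ℝ} (hx : 0 ≤ x) :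
    0 ≤ (-1) ^ n * (arctan x - ∑ i ∈ Finset.range n, (-1) ^ i * x ^ (2 * i + 1) / (2 * i + 1)) := by
  have hderiv (y : ℝ) : HasDerivAt (fun x : ℝ => (-1) ^ n * (arctan x -
      ∑ i ∈ Finset.range n, (-1) ^ i * x ^ (2 * i + 1) / (2 * i + 1)))
      (y ^ (2 * n) / (1 + y ^ 2)) y := by
    have hsum : HasDerivAt (fun x : ℝ =>
        ∑ i ∈ Finset.range n, (-1) ^ i * x ^ (2 * i + 1) / (2 * i + 1))
        (∑ i ∈ Finset.range n, (-y ^ 2) ^ i) y := by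
      refine HasDerivAt.fun_sum fun i _ => ?_
      have h := ((hasDerivAt_pow (2 * i + 1) y).const_mul ((-1 : ℝ) ^ i)).div_const (2 * i + 1)
      refine h.congr_deriv ?_
      have : (2 * i + 1 : ℝ) ≠ 0 := by positivity
      rw [neg_pow (y ^ 2), ← pow_mul]
      push_cast
      field_simp
    refine (((hasDerivAt_arctan y).sub hsum).const_mul ((-1 : ℝ) ^ n)).congr_deriv ?_
    have hy : (1 + y ^ 2 : ℝ) ≠ 0 := by positivity
    have hgeom : (∑ i ∈ Finset.range n, (-y ^ 2) ^ i) * (1 + y ^ 2) = 1 - (-y ^ 2) ^ n := by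
      linear_combination -(geom_sum_mul (-y ^ 2) n)
    have hsq : ((-1 : ℝ) ^ n) * (-1) ^ n = 1 := by rw [← mul_pow]; norm_num
    rw [eq_div_of_mul_eq hy hgeom, neg_pow (y ^ 2), ← pow_mul, ← sub_div, ← mul_div_assoc]
    congr 1
    linear_combination y ^ (2 * n) * hsq
  have hmono := monotone_of_hasDerivAt_nonneg hderiv
    (fun y => div_nonneg ((even_two_mul n).pow_nonneg y) (by positivity))
  simpa using hmono hx

lemma arctan_eq_pi_div_four_add_s16 {t : ℝ} (ht : 0 < t) :
    arctan t = π / 4 + arctan ((t - 1) / (t + 1)) := by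
  have h : 1 * ((t - 1) / (t + 1)) < 1 := by
    rw [one_mul, div_lt_one (by positivity)]; linarith
  rw [← arctan_one, arctan_add h]
  congr 1
  have : t + 1 ≠ 0 := by positivity
  have : t + 1 - (t - 1) ≠ 0 := by ring_nf; norm_num
  field_simp
  ring

/-- Up to a positive factor, the derivative of `B ↦ B * arctan (π / B ^ 2)`
at the point where `π / B ^ 2 = t`. -/
noncomputable def criticalFun (t : ℝ) : ℝ := arctan t - 2 * t / (1 + t ^ 2)

lemma hasDerivAt_criticalFun (t : ℝ) :
    HasDerivAt criticalFun ((3 * t ^ 2 - 1) / (1 + t ^ 2) ^ 2) t := by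
  have h0 : (1 + t ^ 2 : ℝ) ≠ 0 := by positivity
  have h := (hasDerivAt_arctan t).sub
    (((hasDerivAt_id t).const_mul 2).div (((hasDerivAt_id t).pow 2).const_add 1) h0)
  refine h.congr_deriv ?_
  simp
  field_simp
  ring

lemma continuous_criticalFun : Continuous criticalFun :=
  continuous_iff_continuousAt.2 fun t => (hasDerivAt_criticalFun t).continuousAt

lemma strictAntiOn_criticalFun : StrictAntiOn criticalFun (Set.Icc 0 (√3)⁻¹) := by
  refine strictAntiOn_of_deriv_neg (convex_Icc _ _) continuous_criticalFun.continuousOn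
    fun t ht => ?_
  rw [interior_Icc] at ht
  rw [(hasDerivAt_criticalFun t).deriv]
  have h := pow_lt_pow_left₀ ht.2 ht.1.le two_ne_zero
  rw [inv_pow, sq_sqrt (by norm_num)] at h
  exact div_neg_of_neg_of_pos (by linarith) (by positivity)

lemma strictMonoOn_criticalFun : StrictMonoOn criticalFun (Set.Ici (√3)⁻¹) := by
  refine strictMonoOn_of_deriv_pos (convex_Ici _) continuous_criticalFun.continuousOn
    fun t ht => ?_
  rw [interior_Ici, Set.mem_Ioi] at ht
  rw [(hasDerivAt_criticalFun t).deriv]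
  have h := pow_lt_pow_left₀ ht (by positivity) two_ne_zero
  rw [inv_pow, sq_sqrt (by norm_num)] at h
  exact div_pos (by linarith) (by positivity)

lemma criticalFun_neg {t s : ℝ} (ht : 0 < t) (hts : t < s) (hs : criticalFun s = 0) :
    criticalFun t < 0 := by
  rcases le_total t (√3)⁻¹ with h | h
  · have := strictAntiOn_criticalFun ⟨le_rfl, by positivity⟩ ⟨ht.le, h⟩ ht
    simpa [criticalFun] using this
  · exact hs ▸ strictMonoOn_criticalFun h (h.trans hts.le) hts

lemma criticalFun_pos {t s : ℝ} (hs0 : 0 < s) (hst : s < t) (hs : criticalFun s = 0) :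
    0 < criticalFun t := by
  have h : (√3)⁻¹ ≤ s := by
    by_contra! h
    have := strictAntiOn_criticalFun ⟨le_rfl, by positivity⟩ ⟨hs0.le, h.le⟩ hs0
    rw [hs] at this
    simp [criticalFun] at this
  exact hs ▸ strictMonoOn_criticalFun h (h.trans hst.le) hst

lemma exists_criticalFun_eq_zero :
    ∃ t : ℝ, 1.391745199 < t ∧ t < 1.391745202 ∧ criticalFun t = 0 := by
  have hlo : criticalFun 1.391745199 < 0 := by
    have h := arctan_taylor_error_nonneg 7
      (x := (1.391745199 - 1) / (1.391745199 + 1)) (by norm_num)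
    rw [criticalFun, arctan_eq_pi_div_four_add_s16 (by norm_num)]
    norm_num [Finset.sum_range_succ] at h ⊢
    linarith [pi_lt_d20]
  have hhi : 0 < criticalFun 1.391745202 := by
    have h := arctan_taylor_error_nonneg 6
      (x := (1.391745202 - 1) / (1.391745202 + 1)) (by norm_num)
    rw [criticalFun, arctan_eq_pi_div_four_add_s16 (by norm_num)]
    norm_num [Finset.sum_range_succ] at h ⊢
    linarith [pi_gt_d20]
  obtain ⟨t, ⟨h1, h2⟩, h⟩ := intermediate_value_Ioo (by norm_num)
    continuous_criticalFun.continuousOn ⟨hlo, hhi⟩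
  exact ⟨t, h1, h2, h⟩

lemma hasDerivAt_mul_arctan_pi_div_sq {B : ℝ} (hB : B ≠ 0) :
    HasDerivAt (fun B : ℝ => 2 * B / π * arctan (π / B ^ 2))
      (2 / π * criticalFun (π / B ^ 2)) B := by
  have h := (((hasDerivAt_id B).const_mul 2).div_const π).mul
    ((((hasDerivAt_id B).pow 2).fun_inv (pow_ne_zero 2 hB)).const_mul π).arctan
  refine h.congr_deriv ?_
  have h1 : B ^ 4 + π ^ 2 ≠ 0 := by positivity
  simp [criticalFun]
  field_simp
  ring

lemma strictMonoOn_mul_arctan_pi_div_sq {b : ℝ} (hb : 0 < b) (h : criticalFun (π / b ^ 2) = 0) :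
    StrictMonoOn (fun B : ℝ => 2 * B / π * arctan (π / B ^ 2)) (Set.Ioc 0 b) := by
  refine strictMonoOn_of_deriv_pos (convex_Ioc _ _) (fun B hB =>
    (hasDerivAt_mul_arctan_pi_div_sq hB.1.ne').continuousAt.continuousWithinAt) fun B hB => ?_
  rw [interior_Ioc] at hB
  obtain ⟨hB0, hBb⟩ := hB
  rw [(hasDerivAt_mul_arctan_pi_div_sq hB0.ne').deriv]
  exact mul_pos (by positivity) (criticalFun_pos (by positivity) (by gcongr) h)

lemma strictAntiOn_mul_arctan_pi_div_sq {b : ℝ} (hb : 0 < b) (h : criticalFun (π / b ^ 2) = 0) :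
    StrictAntiOn (fun B : ℝ => 2 * B / π * arctan (π / B ^ 2)) (Set.Ici b) := by
  refine strictAntiOn_of_deriv_neg (convex_Ici _) (fun B hB =>
    (hasDerivAt_mul_arctan_pi_div_sq (hb.trans_le hB).ne').continuousAt.continuousWithinAt)
    fun B hB => ?_
  rw [interior_Ici, Set.mem_Ioi] at hB
  have hB0 := hb.trans hB
  rw [(hasDerivAt_mul_arctan_pi_div_sq hB0.ne').deriv]
  exact mul_neg_of_pos_of_neg (by positivity) (criticalFun_neg (by positivity) (by gcongr) h)

/-- The function `B ↦ (2B/π) arctan(π/B²)` on `(0,∞)` attains a maximum value `A₀` at a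
unique point `B₀`, with `1.502432 < B₀ < 1.502433` and `0.9064997 < A₀ < 0.9064998`. -/
theorem exists_unique_max_point :
    ∃ B₀ A₀ : ℝ, 0 < B₀ ∧
      A₀ = 2 * B₀ / Real.pi * Real.arctan (Real.pi / B₀ ^ 2) ∧
      (∀ B : ℝ, 0 < B → 2 * B / Real.pi * Real.arctan (Real.pi / B ^ 2) ≤ A₀) ∧
      (∀ B : ℝ, 0 < B → 2 * B / Real.pi * Real.arctan (Real.pi / B ^ 2) = A₀ → B = B₀) ∧
      1.502432 < B₀ ∧ B₀ < 1.502433 ∧ 0.9064997 < A₀ ∧ A₀ < 0.9064998 := by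
  obtain ⟨t, hlo, hhi, ht⟩ := exists_criticalFun_eq_zero
  have ht0 : 0 < t := lt_trans (by norm_num) hlo
  have hb : 0 < √(π / t) := by positivity
  have hsq : √(π / t) ^ 2 = π / t := sq_sqrt (by positivity)
  have hbt : π / √(π / t) ^ 2 = t := by rw [hsq]; field_simp
  have hcrit : criticalFun (π / √(π / t) ^ 2) = 0 := by rw [hbt, ht]
  have hlt {B : ℝ} (hB : 0 < B) (hne : B ≠ √(π / t)) : 2 * B / π * arctan (π / B ^ 2) <
      2 * √(π / t) / π * arctan (π / √(π / t) ^ 2) := by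
    rcases hne.lt_or_gt with h | h
    · exact strictMonoOn_mul_arctan_pi_div_sq hb hcrit ⟨hB, h.le⟩ ⟨hb, le_rfl⟩ h
    · exact strictAntiOn_mul_arctan_pi_div_sq hb hcrit Set.self_mem_Ici h.le h
  have hmax : (2 * √(π / t) / π * arctan (π / √(π / t) ^ 2)) ^ 2 =
      16 * t / (π * (1 + t ^ 2) ^ 2) := by
    have harctan : arctan t = 2 * t / (1 + t ^ 2) := sub_eq_zero.1 ht
    rw [hbt, harctan, mul_pow, div_pow, mul_pow, hsq]
    field_simp
    norm_num
  have hpi_lo := pi_gt_d20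
  have hpi_hi := pi_lt_d20
  refine ⟨√(π / t), _, hb, rfl, fun B hB => ?_, fun B hB h => ?_, ?_, ?_, ?_, ?_⟩
  · by_cases hne : B = √(π / t)
    · rw [hne]
    · exact (hlt hB hne).le
  · by_contra hne
    exact (hlt hB hne).ne h
  · apply lt_sqrt_of_sq_lt
    rw [lt_div_iff₀ ht0]
    linarith
  · rw [sqrt_lt' (by norm_num), div_lt_iff₀ ht0]
    linarith
  · refine lt_of_pow_lt_pow_left₀ 2 (by have := arctan_pos.2 (hbt.symm ▸ ht0); positivity) ?_
    rw [hmax, lt_div_iff₀ (by positivity)]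
    calc (0.9064997 : ℝ) ^ 2 * (π * (1 + t ^ 2) ^ 2)
        ≤ 0.9064997 ^ 2 * (3.14159265358979323847 * (1 + 1.391745202 ^ 2) ^ 2) := by gcongr
      _ < 16 * 1.391745199 := by norm_num
      _ < 16 * t := by gcongr
  · refine lt_of_pow_lt_pow_left₀ 2 (by norm_num) ?_
    rw [hmax, div_lt_iff₀ (by positivity)]
    calc 16 * t < 16 * 1.391745202 := by gcongr
      _ < 0.9064998 ^ 2 * (3.14159265358979323846 * (1 + 1.391745199 ^ 2) ^ 2) := by norm_num
      _ ≤ (0.9064998 : ℝ) ^ 2 * (π * (1 + t ^ 2) ^ 2) := by gcongr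
end
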